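/- Let A and B be real n × n matrices with B symmetric, A symmetric positive semidefinite, and C·I − A positive semidefinite for a real constant C ≥ 0 (so C dominates the maximum eigenvalue of A). Then (tr(AB))² ≤ n·C·tr(AB²). -/

import Mathlib

open Matrix

/-- The Cauchy–Schwarz inequality for the trace form weighted by a positive semidefinite matrix,
applied to a symmetric matrix and the identity. -/
theorem Matrix.PosSemidef.sq_trace_mul_le {ι : Type*} [Fintype ι] {A B : Matrix ι ι ℝ}
    (hA : A.PosSemidef) (hB : B.IsSymm) :
    (A * B).trace ^ 2 ≤ A.trace * (A * B * B).trace := by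
  classical
  have hquad (t : ℝ) :
      0 ≤ A.trace * (t * t) + 2 * (A * B).trace * t + (A * B * B).trace := by
    have h := (hA.mul_mul_conjTranspose_same (t • 1 + B)).trace_nonneg
    rw [conjTranspose_eq_transpose_of_trivial, transpose_add, transpose_smul, transpose_one,
      hB.eq] at h
    simp only [add_mul, mul_add, smul_mul_assoc, mul_smul_comm, one_mul, mul_one, trace_add,
      trace_smul, smul_eq_mul, trace_mul_comm B A, trace_mul_cycle B A B,
      trace_mul_cycle B B A] at h
    linarith
  have h := discrim_le_zero hquad
  rw [discrim] at h
  linarith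

/-- For real `n × n` matrices with `B` symmetric, `A` symmetric positive semidefinite and
`C·I − A` positive semidefinite for some `C ≥ 0`, one has `(tr(AB))² ≤ n·C·tr(AB²)`. -/
theorem trace_sq_le_trace_of_posSemidef
    {n : ℕ}
    (A B : Matrix (Fin n) (Fin n) ℝ)
    (hB : B.IsSymm)
    (hA : A.PosSemidef)
    (C : ℝ) (hC : 0 ≤ C)
    (hCA : Matrix.PosSemidef (C • (1 : Matrix (Fin n) (Fin n) ℝ) - A)) :
    (Matrix.trace (A * B)) ^ 2 ≤ (n : ℝ) * C * Matrix.trace (A * B * B) := by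
  have htrace : A.trace ≤ n * C := by
    have h := hCA.trace_nonneg
    simp only [trace_sub, trace_smul, trace_one, Fintype.card_fin, smul_eq_mul] at h
    linarith
  have hnonneg : 0 ≤ (A * B * B).trace := by
    have h := (hA.mul_mul_conjTranspose_same B).trace_nonneg
    rwa [conjTranspose_eq_transpose_of_trivial, hB.eq, trace_mul_cycle, trace_mul_cycle] at h
  exact (hA.sq_trace_mul_le hB).trans (mul_le_mul_of_nonneg_right htrace hnonneg)
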